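/- Fix R > 0 and λ > 0. There exists a constant C such that for all ξ ≥ 1 with ξ ≠ λ, |∫₀^R J₀(λr)·J₀(ξr)·r dr| ≤ C·ξ^{−3/2}; that is, the finite Hankel transform of J₀(λ·) on [0,R] decays like O(ξ^{−3/2}) as ξ → ∞. -/

import Mathlib

open MeasureTheory

/-- Bessel function of the first kind of order zero (integral representation). -/
noncomputable def besselJ0 (x : ℝ) : ℝ :=
  (1 / Real.pi) * ∫ θ in (0:ℝ)..Real.pi, Real.cos (x * Real.sin θ)

/-- Bessel function of the first kind of order one. -/
noncomputable def besselJ1 (x : ℝ) : ℝ :=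
  (1 / Real.pi) * ∫ θ in (0:ℝ)..Real.pi, Real.sin θ * Real.sin (x * Real.sin θ)

theorem hasDerivAt_besselJ0 (x : ℝ) : HasDerivAt besselJ0 (-besselJ1 x) x := by
  have h := (intervalIntegral.hasDerivAt_integral_of_dominated_loc_of_deriv_le (μ := volume)
    (F := fun x θ : ℝ => Real.cos (x * Real.sin θ))
    (F' := fun x θ : ℝ => -(Real.sin θ * Real.sin (x * Real.sin θ)))
    (a := 0) (b := Real.pi) (x₀ := x) (s := Set.univ) (bound := fun _ => 1) Filter.univ_mem
    (.of_forall fun y => (by fun_prop : Continuous _).aestronglyMeasurable)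
    ((by fun_prop : Continuous _).intervalIntegrable _ _)
    (by fun_prop : Continuous _).aestronglyMeasurable
    (.of_forall fun θ _ y _ => by
      rw [norm_neg, norm_mul, Real.norm_eq_abs, Real.norm_eq_abs]
      exact mul_le_one₀ (Real.abs_sin_le_one _) (abs_nonneg _) (Real.abs_sin_le_one _))
    (continuous_const.intervalIntegrable _ _)
    (.of_forall fun θ _ y _ => by
      refine ((hasDerivAt_id y).mul_const (Real.sin θ)).cos.congr_deriv ?_
      simp only [id]
      ring)).2
  refine (h.const_mul (1 / Real.pi)).congr_deriv ?_
  simp [besselJ1]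

theorem hasDerivAt_besselJ1_integral (x : ℝ) : HasDerivAt besselJ1
    ((1 / Real.pi) * ∫ θ in (0:ℝ)..Real.pi, Real.sin θ ^ 2 * Real.cos (x * Real.sin θ)) x := by
  have h := (intervalIntegral.hasDerivAt_integral_of_dominated_loc_of_deriv_le (μ := volume)
    (F := fun x θ : ℝ => Real.sin θ * Real.sin (x * Real.sin θ))
    (F' := fun x θ : ℝ => Real.sin θ ^ 2 * Real.cos (x * Real.sin θ))
    (a := 0) (b := Real.pi) (x₀ := x) (s := Set.univ) (bound := fun _ => 1) Filter.univ_mem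
    (.of_forall fun y => (by fun_prop : Continuous _).aestronglyMeasurable)
    ((by fun_prop : Continuous _).intervalIntegrable _ _)
    (by fun_prop : Continuous _).aestronglyMeasurable
    (.of_forall fun θ _ y _ => by
      rw [norm_mul, norm_pow, Real.norm_eq_abs, Real.norm_eq_abs]
      exact mul_le_one₀ (pow_le_one₀ (abs_nonneg _) (Real.abs_sin_le_one _)) (abs_nonneg _)
        (Real.abs_cos_le_one _))
    (continuous_const.intervalIntegrable _ _)
    (.of_forall fun θ _ y _ => by
      refine ((((hasDerivAt_id y).mul_const (Real.sin θ)).sin).const_mul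
        (Real.sin θ)).congr_deriv ?_
      simp only [id]
      ring)).2
  exact h.const_mul (1 / Real.pi)

theorem besselJ1_eq_mul_integral (x : ℝ) : besselJ1 x =
    x * (besselJ0 x -
      (1 / Real.pi) * ∫ θ in (0:ℝ)..Real.pi, Real.sin θ ^ 2 * Real.cos (x * Real.sin θ)) := by
  have h : ∫ θ in (0:ℝ)..Real.pi,
      (x * (Real.cos (x * Real.sin θ) - Real.sin θ ^ 2 * Real.cos (x * Real.sin θ))
        - Real.sin θ * Real.sin (x * Real.sin θ)) = 0 := by
    rw [intervalIntegral.integral_eq_sub_of_hasDerivAt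
      (f := fun θ => Real.cos θ * Real.sin (x * Real.sin θ))]
    · simp
    · intro θ _
      refine ((Real.hasDerivAt_cos θ).mul
        (((Real.hasDerivAt_sin θ).const_mul x).sin)).congr_deriv ?_
      linear_combination
        x * Real.cos (x * Real.sin θ) * Real.sin_sq_add_cos_sq θ
    · exact (by fun_prop : Continuous _).intervalIntegrable _ _
  rw [intervalIntegral.integral_sub ((by fun_prop : Continuous _).intervalIntegrable _ _)
    ((by fun_prop : Continuous _).intervalIntegrable _ _), intervalIntegral.integral_const_mul,
    intervalIntegral.integral_sub ((by fun_prop : Continuous _).intervalIntegrable _ _)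
    ((by fun_prop : Continuous _).intervalIntegrable _ _)] at h
  unfold besselJ1 besselJ0
  linear_combination -(1 / Real.pi) * h

theorem hasDerivAt_besselJ1 {x : ℝ} (hx : x ≠ 0) :
    HasDerivAt besselJ1 (besselJ0 x - besselJ1 x / x) x := by
  refine (hasDerivAt_besselJ1_integral x).congr_deriv ?_
  have h := besselJ1_eq_mul_integral x
  field_simp at h ⊢
  linear_combination h

theorem continuous_besselJ0 : Continuous besselJ0 :=
  continuous_iff_continuousAt.2 fun x => (hasDerivAt_besselJ0 x).continuousAt

theorem continuous_besselJ1 : Continuous besselJ1 :=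
  continuous_iff_continuousAt.2 fun x => (hasDerivAt_besselJ1_integral x).continuousAt

theorem abs_average_zero_pi_le_one {f : ℝ → ℝ} (hf : ∀ θ, |f θ| ≤ 1) :
    |(1 / Real.pi) * ∫ θ in (0:ℝ)..Real.pi, f θ| ≤ 1 := by
  have h := intervalIntegral.norm_integral_le_of_norm_le_const (a := 0) (b := Real.pi)
    (f := f) (C := 1) fun θ _ => hf θ
  rw [sub_zero, abs_of_pos Real.pi_pos, one_mul, Real.norm_eq_abs] at h
  rw [abs_mul, abs_of_pos (one_div_pos.2 Real.pi_pos), one_div, inv_mul_le_iff₀ Real.pi_pos,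
    mul_one]
  exact h

theorem abs_besselJ0_le_one (x : ℝ) : |besselJ0 x| ≤ 1 :=
  abs_average_zero_pi_le_one fun _ => Real.abs_cos_le_one _

theorem abs_besselJ1_le_one (x : ℝ) : |besselJ1 x| ≤ 1 :=
  abs_average_zero_pi_le_one fun θ => by
    rw [abs_mul]
    exact mul_le_one₀ (Real.abs_sin_le_one _) (abs_nonneg _) (Real.abs_sin_le_one _)

/-- An energy functional for the Bessel equation, almost conserved for large `x`. -/
noncomputable def besselEnergy (x : ℝ) : ℝ :=
  x * (besselJ0 x ^ 2 + besselJ1 x ^ 2) - besselJ0 x * besselJ1 x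

theorem hasDerivAt_besselEnergy {x : ℝ} (hx : x ≠ 0) :
    HasDerivAt besselEnergy (besselJ0 x * besselJ1 x / x) x := by
  have h0 := hasDerivAt_besselJ0 x
  have h1 := hasDerivAt_besselJ1 hx
  refine (((hasDerivAt_id x).mul ((h0.pow 2).add (h1.pow 2))).sub (h0.mul h1)).congr_deriv ?_
  simp
  field_simp
  ring

theorem le_besselEnergy (x : ℝ) :
    (x - 1 / 2) * (besselJ0 x ^ 2 + besselJ1 x ^ 2) ≤ besselEnergy x := by
  unfold besselEnergy
  nlinarith [sq_nonneg (besselJ0 x - besselJ1 x)]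

theorem besselEnergy_le {x : ℝ} (hx : 1 ≤ x) : besselEnergy x ≤ 9 := by
  have hd : ∀ y : ℝ, 1 ≤ y → HasDerivAt (fun y => besselEnergy y * Real.exp y⁻¹)
      (besselJ0 y * besselJ1 y / y * Real.exp y⁻¹
        + besselEnergy y * (Real.exp y⁻¹ * (-(y ^ 2)⁻¹))) y := fun y hy =>
    (hasDerivAt_besselEnergy (by linarith)).mul (hasDerivAt_inv (by linarith)).exp
  have hanti : AntitoneOn (fun y => besselEnergy y * Real.exp y⁻¹) (Set.Ici 1) := by
    refine antitoneOn_of_deriv_nonpos (convex_Ici 1)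
      (fun y hy => (hd y hy).continuousAt.continuousWithinAt)
      (fun y hy => (hd y (interior_subset hy)).differentiableAt.differentiableWithinAt)
      fun y hy => ?_
    have hy1 : 1 ≤ y := interior_subset hy
    have hy0 : 0 < y := by linarith
    rw [(hd y hy1).deriv]
    have hE := le_besselEnergy y
    have key : y * (besselJ0 y * besselJ1 y) ≤ besselEnergy y := by
      nlinarith [mul_nonneg hy0.le (sq_nonneg (besselJ0 y - besselJ1 y)),
        mul_nonneg (sub_nonneg.2 hy1) (add_nonneg (sq_nonneg (besselJ0 y))
          (sq_nonneg (besselJ1 y)))]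
    have : besselJ0 y * besselJ1 y / y * Real.exp y⁻¹
        + besselEnergy y * (Real.exp y⁻¹ * (-(y ^ 2)⁻¹))
        = -(Real.exp y⁻¹ / y ^ 2 * (besselEnergy y - y * (besselJ0 y * besselJ1 y))) := by
      field_simp
      ring
    rw [this, neg_nonpos]
    exact mul_nonneg (by positivity) (sub_nonneg.2 key)
  have h := hanti Set.self_mem_Ici hx hx
  simp only [inv_one] at h
  have h1 : besselEnergy 1 ≤ 3 := by
    have a0 := abs_le.1 (abs_besselJ0_le_one 1)
    have a1 := abs_le.1 (abs_besselJ1_le_one 1)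
    unfold besselEnergy
    nlinarith
  have hE0 : 0 ≤ besselEnergy x :=
    (mul_nonneg (by linarith) (by positivity)).trans (le_besselEnergy x)
  have he : 1 ≤ Real.exp x⁻¹ := Real.one_le_exp (by positivity)
  have he3 := Real.exp_one_lt_three
  nlinarith [Real.exp_pos 1]

theorem mul_besselJ1_sq_le (x : ℝ) : x * besselJ1 x ^ 2 ≤ 18 := by
  rcases le_total x 1 with h | h
  · nlinarith [sq_le_one_iff_abs_le_one (besselJ1 x) |>.2 (abs_besselJ1_le_one x),
      sq_nonneg (besselJ1 x)]
  · nlinarith [besselEnergy_le h, le_besselEnergy x, sq_nonneg (besselJ1 x),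
      mul_nonneg (by linarith : 0 ≤ x - 1 / 2) (sq_nonneg (besselJ0 x)),
      mul_nonneg (sub_nonneg.2 h) (sq_nonneg (besselJ1 x))]

theorem sqrt_mul_abs_besselJ1_le {x : ℝ} (hx : 0 ≤ x) : √x * |besselJ1 x| ≤ 5 := by
  refine abs_le_of_sq_le_sq' ?_ (by norm_num) |>.2
  rw [mul_pow, Real.sq_sqrt hx, sq_abs]
  linarith [mul_besselJ1_sq_le x]

theorem sqrt_mul_abs_mul_besselJ1_le {ξ r : ℝ} (hξ : 0 ≤ ξ) (hr : 0 ≤ r) :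
    √ξ * |r * besselJ1 (ξ * r)| ≤ 5 * √r := by
  have h := mul_le_mul_of_nonneg_right (sqrt_mul_abs_besselJ1_le (mul_nonneg hξ hr))
    (Real.sqrt_nonneg r)
  rw [Real.sqrt_mul hξ] at h
  rw [abs_mul, abs_of_nonneg hr]
  calc √ξ * (r * |besselJ1 (ξ * r)|) = √ξ * ((√r * √r) * |besselJ1 (ξ * r)|) := by
        rw [Real.mul_self_sqrt hr]
    _ = √ξ * √r * |besselJ1 (ξ * r)| * √r := by ring
    _ ≤ 5 * √r := h

theorem integral_besselJ0_mul_besselJ0 (R lam ξ : ℝ) :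
    ξ * ∫ r in (0:ℝ)..R, besselJ0 (lam * r) * besselJ0 (ξ * r) * r =
      besselJ0 (lam * R) * (R * besselJ1 (ξ * R)) +
        lam * ∫ r in (0:ℝ)..R, besselJ1 (lam * r) * (r * besselJ1 (ξ * r)) := by
  have c0 := continuous_besselJ0
  have c1 := continuous_besselJ1
  have hu : ∀ r : ℝ, HasDerivAt (fun r => besselJ0 (lam * r)) (-lam * besselJ1 (lam * r)) r := by
    intro r
    refine ((hasDerivAt_besselJ0 (lam * r)).comp r
      ((hasDerivAt_id r).const_mul lam)).congr_deriv ?_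
    ring
  have hv : ∀ r : ℝ, HasDerivAt (fun r => r * besselJ1 (ξ * r)) (ξ * (besselJ0 (ξ * r) * r)) r := by
    intro r
    refine ((hasDerivAt_id r).mul ((hasDerivAt_besselJ1_integral (ξ * r)).comp r
      ((hasDerivAt_id r).const_mul ξ))).congr_deriv ?_
    simp only [id, Function.comp]
    linear_combination besselJ1_eq_mul_integral (ξ * r)
  have h := intervalIntegral.integral_mul_deriv_eq_deriv_mul (a := 0) (b := R)
    (fun r _ => hu r) (fun r _ => hv r)
    ((by fun_prop : Continuous _).intervalIntegrable _ _)
    ((by fun_prop : Continuous _).intervalIntegrable _ _)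
  rw [← intervalIntegral.integral_const_mul, ← intervalIntegral.integral_const_mul]
  simp only [neg_mul, intervalIntegral.integral_neg, zero_mul, mul_zero, sub_zero,
    sub_neg_eq_add] at h
  refine (intervalIntegral.integral_congr fun r _ => ?_).trans
    (h.trans (congrArg _ (intervalIntegral.integral_congr fun r _ => ?_))) <;>
  ring

theorem finite_hankel_J0_decay
    (R lam : ℝ) (hR : 0 < R) (hlam : 0 < lam) :
    ∃ C : ℝ, ∀ ξ : ℝ, 1 ≤ ξ → ξ ≠ lam →
      |∫ r in (0:ℝ)..R, besselJ0 (lam * r) * besselJ0 (ξ * r) * r|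
        ≤ C * ξ ^ (-(3:ℝ) / 2) := by
  refine ⟨5 * √R + lam * (5 * √R * R), fun ξ hξ _ => ?_⟩
  have hξ0 : 0 < ξ := by linarith
  have hs : 0 < √ξ := Real.sqrt_pos.2 hξ0
  have hpow : ξ ^ (-(3:ℝ) / 2) = (ξ * √ξ)⁻¹ := by
    rw [neg_div, Real.rpow_neg hξ0.le, Real.sqrt_eq_rpow, ← Real.rpow_one_add' hξ0.le (by norm_num)]
    norm_num
  have hpt : ∀ r ∈ Set.uIoc 0 R,
      ‖besselJ1 (lam * r) * (r * besselJ1 (ξ * r))‖ ≤ 5 * √R / √ξ := by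
    intro r hr
    rw [Set.uIoc_of_le hR.le] at hr
    rw [Real.norm_eq_abs, abs_mul, le_div_iff₀ hs]
    have h1 := sqrt_mul_abs_mul_besselJ1_le hξ0.le hr.1.le
    have h2 := Real.sqrt_le_sqrt hr.2
    nlinarith [mul_le_mul_of_nonneg_right (abs_besselJ1_le_one (lam * r))
      (mul_nonneg hs.le (abs_nonneg (r * besselJ1 (ξ * r))))]
  have hint := intervalIntegral.norm_integral_le_of_norm_le_const hpt
  rw [sub_zero, abs_of_pos hR, Real.norm_eq_abs] at hint
  have hbdry : |besselJ0 (lam * R) * (R * besselJ1 (ξ * R))| ≤ 5 * √R / √ξ := by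
    rw [abs_mul, le_div_iff₀ hs]
    nlinarith [sqrt_mul_abs_mul_besselJ1_le hξ0.le hR.le,
      mul_le_mul_of_nonneg_right (abs_besselJ0_le_one (lam * R))
        (mul_nonneg hs.le (abs_nonneg (R * besselJ1 (ξ * R))))]
  have key := congrArg abs (integral_besselJ0_mul_besselJ0 R lam ξ)
  rw [abs_mul, abs_of_pos hξ0] at key
  rw [hpow, ← div_eq_mul_inv, le_div_iff₀ (by positivity), mul_comm, mul_right_comm, key]
  rw [← le_div_iff₀ hs]
  refine (abs_add_le _ _).trans ?_
  rw [abs_mul lam, abs_of_pos hlam]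
  calc _ ≤ 5 * √R / √ξ + lam * (5 * √R / √ξ * R) := by gcongr
    _ = _ := by ring
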